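/- arXiv:1901.08375 — 2 statements merged into one kernel-verified Lean document; each statement's English description precedes it below -/
import Mathlib

section
/- Let k be an algebraically closed field of characteristic 3 and X a trigonal curve of genus 5 over k. Then a(X) ≤ 3; equivalently, the rank of the Hasse–Witt matrix of X is at least 2. -/
open MvPolynomial

/-- The Hasse–Witt matrix of the trigonal genus-5 curve with singular quintic plane model
`F = 0` in characteristic `p` (Kudo–Harashita, Proposition 2.3.1): the `(l, m)` entry is the
coefficient of `x^(p·i_l − i_m) y^(p·j_l − j_m) z^(p·k_l − k_m)` in `F^(p−1)`
(zero when some exponent is negative), with `(i_l, j_l, k_l)` given by the table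
`(3,1,1), (1,3,1), (2,2,1), (2,1,2), (1,2,2)`. -/
noncomputable def hasseWittQuintic {k : Type*} [Field k] (p : ℕ)
    (F : MvPolynomial (Fin 3) k) : Matrix (Fin 5) (Fin 5) k :=
  fun l m =>
    let iv : Fin 5 → ℕ := ![3, 1, 2, 2, 1]
    let jv : Fin 5 → ℕ := ![1, 3, 2, 1, 2]
    let kv : Fin 5 → ℕ := ![1, 1, 1, 2, 2]
    if iv m ≤ p * iv l ∧ jv m ≤ p * jv l ∧ kv m ≤ p * kv l then
      MvPolynomial.coeff
        (Finsupp.single (0 : Fin 3) (p * iv l - iv m) +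
          Finsupp.single (1 : Fin 3) (p * jv l - jv m) +
          Finsupp.single (2 : Fin 3) (p * kv l - kv m)) (F ^ (p - 1))
    else 0

/-- The coefficient of `x^(5-j-l) y^j z^l` in `F`, extended by zero. -/
noncomputable def quinticCoeff {k : Type*} [Field k] (F : MvPolynomial (Fin 3) k) (j l : ℕ) : k :=
  if j + l ≤ 5 then
    MvPolynomial.coeff (Finsupp.single (0 : Fin 3) (5 - (j + l)) + Finsupp.single (1 : Fin 3) j +
      Finsupp.single (2 : Fin 3) l) F
  else 0

section

variable {k : Type*} [Field k]

theorem single_add_single_add_single_eq (m : Fin 3 →₀ ℕ) :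
    Finsupp.single (0 : Fin 3) (m 0) + Finsupp.single (1 : Fin 3) (m 1) +
      Finsupp.single (2 : Fin 3) (m 2) = m := by
  ext i; fin_cases i <;> simp

theorem degree_fin_three (m : Fin 3 →₀ ℕ) : m.degree = m 0 + m 1 + m 2 := by
  simp [Finsupp.degree_eq_sum, Fin.sum_univ_three]

theorem MvPolynomial.IsHomogeneous.add_eq_of_coeff_ne_zero {F : MvPolynomial (Fin 3) k} {n : ℕ}
    (hF : F.IsHomogeneous n) {m : Fin 3 →₀ ℕ} (hm : coeff m F ≠ 0) : m 0 + m 1 + m 2 = n := by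
  by_contra h
  exact hm (hF.coeff_eq_zero (by rwa [degree_fin_three]))

theorem coeff_eq_quinticCoeff {F : MvPolynomial (Fin 3) k} {m : Fin 3 →₀ ℕ}
    (hm : m 0 + m 1 + m 2 = 5) : coeff m F = quinticCoeff F (m 1) (m 2) := by
  rw [quinticCoeff, if_pos (by omega), show 5 - (m 1 + m 2) = m 0 by omega,
    single_add_single_add_single_eq]

theorem quinticCoeff_eq_zero (F : MvPolynomial (Fin 3) k) {j l : ℕ} (h : 5 < j + l) :
    quinticCoeff F j l = 0 :=
  if_neg (by omega)

theorem coeff_sq_eq_sum_quinticCoeff {F : MvPolynomial (Fin 3) k} (hF : F.IsHomogeneous 5)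
    {i j l : ℕ} (h : i + j + l = 10) :
    coeff (Finsupp.single (0 : Fin 3) i + Finsupp.single (1 : Fin 3) j +
      Finsupp.single (2 : Fin 3) l) (F ^ 2) =
    ∑ p ∈ Finset.HasAntidiagonal.antidiagonal j ×ˢ Finset.HasAntidiagonal.antidiagonal l,
      quinticCoeff F p.1.1 p.2.1 * quinticCoeff F p.1.2 p.2.2 := by
  classical
  rw [sq, coeff_mul]
  refine Finset.sum_bij_ne_zero (fun x _ _ => ((x.1 1, x.2 1), (x.1 2, x.2 2))) ?_ ?_ ?_ ?_
  · rintro ⟨a, b⟩ hab _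
    have hab := Finset.HasAntidiagonal.mem_antidiagonal.1 hab
    simp only [Finset.mem_product, Finset.HasAntidiagonal.mem_antidiagonal]
    constructor
    · simpa using DFunLike.congr_fun hab 1
    · simpa using DFunLike.congr_fun hab 2
  · rintro ⟨a, b⟩ _ h₁ ⟨a', b'⟩ _ h₂ hp
    have e₁ := hF.add_eq_of_coeff_ne_zero (left_ne_zero_of_mul h₁)
    have e₂ := hF.add_eq_of_coeff_ne_zero (right_ne_zero_of_mul h₁)
    have e₃ := hF.add_eq_of_coeff_ne_zero (left_ne_zero_of_mul h₂)
    have e₄ := hF.add_eq_of_coeff_ne_zero (right_ne_zero_of_mul h₂)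
    simp only [Prod.mk.injEq] at hp e₁ e₂ e₃ e₄ ⊢
    constructor <;> ext t <;> fin_cases t <;> simp <;> omega
  · rintro ⟨⟨j₁, j₂⟩, l₁, l₂⟩ hp hne
    simp only [Finset.mem_product, Finset.HasAntidiagonal.mem_antidiagonal] at hp
    have h₁ : j₁ + l₁ ≤ 5 := by
      by_contra hlt
      exact left_ne_zero_of_mul hne (quinticCoeff_eq_zero F (not_le.1 hlt))
    have h₂ : j₂ + l₂ ≤ 5 := by
      by_contra hlt
      exact right_ne_zero_of_mul hne (quinticCoeff_eq_zero F (not_le.1 hlt))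
    refine ⟨(Finsupp.single 0 (5 - (j₁ + l₁)) + Finsupp.single 1 j₁ + Finsupp.single 2 l₁,
      Finsupp.single 0 (5 - (j₂ + l₂)) + Finsupp.single 1 j₂ + Finsupp.single 2 l₂), ?_, ?_, ?_⟩
    · rw [Finset.HasAntidiagonal.mem_antidiagonal]
      ext t
      fin_cases t <;> simp <;> omega
    · simpa [quinticCoeff, h₁, h₂] using hne
    · simp
  · rintro ⟨a, b⟩ _ h₁
    rw [coeff_eq_quinticCoeff (hF.add_eq_of_coeff_ne_zero (left_ne_zero_of_mul h₁)),
      coeff_eq_quinticCoeff (hF.add_eq_of_coeff_ne_zero (right_ne_zero_of_mul h₁))]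

theorem eq_sum_quinticCoeff {F : MvPolynomial (Fin 3) k} (hF : F.IsHomogeneous 5)
    (h : ∀ j l, 4 ≤ l → quinticCoeff F j l = 0) :
    F = ∑ l ∈ Finset.range 4, ∑ j ∈ Finset.range (6 - l),
      C (quinticCoeff F j l) * X 0 ^ (5 - (j + l)) * X 1 ^ j * X 2 ^ l := by
  classical
  have hmon : ∀ j l, C (quinticCoeff F j l) * X 0 ^ (5 - (j + l)) * X 1 ^ j * X 2 ^ l =
      monomial (Finsupp.single (0 : Fin 3) (5 - (j + l)) + Finsupp.single (1 : Fin 3) j +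
        Finsupp.single (2 : Fin 3) l) (quinticCoeff F j l) := by
    intro j l
    simp only [X_pow_eq_monomial, C_mul_monomial, monomial_mul, mul_one]
  simp only [hmon]
  ext m
  simp only [coeff_sum, coeff_monomial]
  by_cases hm : m 0 + m 1 + m 2 = 5
  · rw [coeff_eq_quinticCoeff hm]
    have key : ∀ j l, (Finsupp.single (0 : Fin 3) (5 - (j + l)) + Finsupp.single (1 : Fin 3) j +
        Finsupp.single (2 : Fin 3) l = m) ↔ (m 2 = l ∧ m 1 = j) := by
      intro j l
      constructor
      · rintro rfl
        simp
      · rintro ⟨rfl, rfl⟩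
        rw [show 5 - (m 1 + m 2) = m 0 by omega, single_add_single_add_single_eq]
    simp only [key, ite_and]
    by_cases hl : 4 ≤ m 2
    · rw [h _ _ hl, Finset.sum_eq_zero]
      intro l hl'
      rw [Finset.mem_range] at hl'
      simp [show m 2 ≠ l by omega]
    · rw [Finset.sum_eq_single_of_mem (m 2) (by simp; omega) (by intro b _ hb; simp [hb.symm]),
        Finset.sum_eq_single_of_mem (m 1) (by simp; omega) (by intro b _ hb; simp [hb.symm])]
      simp
  · rw [hF.coeff_eq_zero (by rwa [degree_fin_three]), Finset.sum_eq_zero]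
    intro l hl
    refine Finset.sum_eq_zero fun j hj => if_neg ?_
    rintro rfl
    simp only [Finset.mem_range] at hl hj
    apply hm
    simp
    omega

theorem hasseWittQuintic_three_apply {F : MvPolynomial (Fin 3) k} (hF : F.IsHomogeneous 5)
    (l m : Fin 5) :
    hasseWittQuintic 3 F l m =
      ∑ p ∈ Finset.HasAntidiagonal.antidiagonal (3 * ![1, 3, 2, 1, 2] l - ![1, 3, 2, 1, 2] m) ×ˢ
          Finset.HasAntidiagonal.antidiagonal (3 * ![1, 1, 1, 2, 2] l - ![1, 1, 1, 2, 2] m),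
        quinticCoeff F p.1.1 p.2.1 * quinticCoeff F p.1.2 p.2.2 := by
  rw [← coeff_sq_eq_sum_quinticCoeff hF
    (i := 3 * ![3, 1, 2, 2, 1] l - ![3, 1, 2, 2, 1] m) (by decide +revert)]
  rw [hasseWittQuintic, if_pos (by decide +revert)]

theorem Matrix.mul_eq_mul_of_rank_lt_two {m n : Type*} [Fintype m] [Fintype n] {A : Matrix m n k}
    (hA : A.rank < 2) (i i' : m) (j j' : n) : A i j * A i' j' = A i j' * A i' j := by
  by_contra h
  have hu : IsUnit (A.submatrix ![i, i'] ![j, j']) := by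
    rw [Matrix.isUnit_iff_isUnit_det, Matrix.det_fin_two]
    simpa [sub_eq_zero] using h
  have := Matrix.rank_submatrix_le A ![i, i'] ![j, j']
  rw [Matrix.rank_of_isUnit _ hu, Fintype.card_fin] at this
  omega

set_option maxHeartbeats 1000000 in
theorem hasseWittQuintic_three_eq {F : MvPolynomial (Fin 3) k}
    (hF : F.IsHomogeneous 5) (hF₄ : ∀ j l, 4 ≤ l → quinticCoeff F j l = 0) :
    hasseWittQuintic 3 F =
      let a := quinticCoeff F
      !![2 * a 0 1 * a 2 1 + a 1 1 ^ 2 + 2 * a 0 2 * a 2 0 + 2 * a 1 2 * a 1 0 + 2 * a 2 2 *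
            a 0 0,
          a 0 1 ^ 2 + 2 * a 0 2 * a 0 0,
          2 * a 0 1 * a 1 1 + 2 * a 0 2 * a 1 0 + 2 * a 1 2 * a 0 0,
          2 * a 0 1 * a 2 0 + 2 * a 1 1 * a 1 0 + 2 * a 2 1 * a 0 0,
          2 * a 0 1 * a 1 0 + 2 * a 1 1 * a 0 0;
        a 4 1 ^ 2 + 2 * a 3 2 * a 5 0,
          2 * a 2 1 * a 4 1 + a 3 1 ^ 2 + 2 * a 1 2 * a 5 0 + 2 * a 2 2 * a 4 0 + 2 * a 3 2 *
            a 3 0,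
          2 * a 3 1 * a 4 1 + 2 * a 2 2 * a 5 0 + 2 * a 3 2 * a 4 0,
          2 * a 3 1 * a 5 0 + 2 * a 4 1 * a 4 0,
          2 * a 2 1 * a 5 0 + 2 * a 3 1 * a 4 0 + 2 * a 4 1 * a 3 0;
        2 * a 1 1 * a 4 1 + 2 * a 2 1 * a 3 1 + 2 * a 0 2 * a 5 0 + 2 * a 1 2 * a 4 0 + 2 *
            a 2 2 * a 3 0 + 2 * a 3 2 * a 2 0,
          2 * a 0 1 * a 3 1 + 2 * a 1 1 * a 2 1 + 2 * a 0 2 * a 3 0 + 2 * a 1 2 * a 2 0 + 2 *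
            a 2 2 * a 1 0 + 2 * a 3 2 * a 0 0,
          2 * a 0 1 * a 4 1 + 2 * a 1 1 * a 3 1 + a 2 1 ^ 2 + 2 * a 0 2 * a 4 0 + 2 * a 1 2 *
            a 3 0 + 2 * a 2 2 * a 2 0 + 2 * a 3 2 * a 1 0,
          2 * a 0 1 * a 5 0 + 2 * a 1 1 * a 4 0 + 2 * a 2 1 * a 3 0 + 2 * a 3 1 * a 2 0 + 2 *
            a 4 1 * a 1 0,
          2 * a 0 1 * a 4 0 + 2 * a 1 1 * a 3 0 + 2 * a 2 1 * a 2 0 + 2 * a 3 1 * a 1 0 + 2 *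
            a 4 1 * a 0 0;
        2 * a 0 3 * a 2 2 + 2 * a 1 3 * a 1 2 + 2 * a 2 3 * a 0 2,
          2 * a 0 3 * a 0 2,
          2 * a 0 3 * a 1 2 + 2 * a 1 3 * a 0 2,
          2 * a 0 2 * a 2 2 + a 1 2 ^ 2 + 2 * a 0 3 * a 2 1 + 2 * a 1 3 * a 1 1 + 2 * a 2 3 *
            a 0 1,
          2 * a 0 2 * a 1 2 + 2 * a 0 3 * a 1 1 + 2 * a 1 3 * a 0 1;
        2 * a 2 3 * a 3 2,
          2 * a 0 3 * a 3 2 + 2 * a 1 3 * a 2 2 + 2 * a 2 3 * a 1 2,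
          2 * a 1 3 * a 3 2 + 2 * a 2 3 * a 2 2,
          2 * a 2 2 * a 3 2 + 2 * a 1 3 * a 4 1 + 2 * a 2 3 * a 3 1,
          2 * a 1 2 * a 3 2 + a 2 2 ^ 2 + 2 * a 0 3 * a 4 1 + 2 * a 1 3 * a 3 1 + 2 * a 2 3 *
            a 2 1] := by
  have h := @quinticCoeff_eq_zero k _ F
  ext l m
  rw [hasseWittQuintic_three_apply hF]
  fin_cases l <;> fin_cases m <;>
    simp [Finset.sum_product, Finset.Nat.antidiagonal_succ, h, hF₄] <;> ring

/-- In characteristic `3`, the quintic `∑ a j l x^(5-j-l) y^j z^l` with `a 2 3 = 0` has vanishing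
partial derivatives at a point other than `(0 : 0 : 1)`. -/
def HasSingularPoint (a : ℕ → ℕ → k) : Prop :=
  ∃ x y z : k, (x ≠ 0 ∨ y ≠ 0) ∧
    (2 * a 0 3 * x + a 1 3 * y) * z ^ 3 + (2 * a 1 2 * x * y + a 2 2 * y ^ 2) * z ^ 2 +
      (a 0 1 * x ^ 3 + 2 * a 2 1 * x * y ^ 2 + a 3 1 * y ^ 3) * z +
      (2 * a 0 0 * x ^ 4 + a 1 0 * x ^ 3 * y + 2 * a 3 0 * x * y ^ 3 + a 4 0 * y ^ 4) = 0 ∧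
    a 1 3 * x * z ^ 3 + (a 1 2 * x ^ 2 + 2 * a 2 2 * x * y) * z ^ 2 +
      (a 1 1 * x ^ 3 + 2 * a 2 1 * x ^ 2 * y + a 4 1 * y ^ 3) * z +
      (a 1 0 * x ^ 4 + 2 * a 2 0 * x ^ 3 * y + a 4 0 * x * y ^ 3 + 2 * a 5 0 * y ^ 4) = 0 ∧
    2 * (a 0 2 * x ^ 3 + a 1 2 * x ^ 2 * y + a 2 2 * x * y ^ 2 + a 3 2 * y ^ 3) * z +
      (a 0 1 * x ^ 4 + a 1 1 * x ^ 3 * y + a 2 1 * x ^ 2 * y ^ 2 + a 3 1 * x * y ^ 3 +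
        a 4 1 * y ^ 4) = 0

theorem HasSingularPoint.exists_eval_pderiv_eq_zero [CharP k 3] {F : MvPolynomial (Fin 3) k}
    (hF : F.IsHomogeneous 5) (hF₄ : ∀ j l, 4 ≤ l → quinticCoeff F j l = 0)
    (h₂ : quinticCoeff F 2 3 = 0) (h : HasSingularPoint (quinticCoeff F)) :
    ∃ Q : Fin 3 → k, (Q 0 ≠ 0 ∨ Q 1 ≠ 0) ∧ (∀ i, eval Q (pderiv i F) = 0) ∧ eval Q F = 0 := by
  obtain ⟨x, y, z, hxy, hx, hy, hz⟩ := h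
  have hsum := eq_sum_quinticCoeff hF hF₄
  generalize quinticCoeff F = a at *
  have h3 : (3 : k) = 0 := CharP.cast_eq_zero k 3
  subst hsum
  refine ⟨![x, y, z], by simpa using hxy, fun i => ?_, ?_⟩
  · fin_cases i
    · simp [Finset.sum_range_succ, pderiv_X, h₂, h3]
      linear_combination (norm := grind) hx
    · simp [Finset.sum_range_succ, pderiv_X, h₂, h3]
      linear_combination (norm := grind) hy
    · simp [Finset.sum_range_succ, pderiv_X, h₂, h3]
      linear_combination (norm := grind) hz
  · simp [Finset.sum_range_succ, h₂]
    linear_combination (norm := grind) 2 * x * hx + 2 * y * hy + 2 * z * hz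

variable [IsAlgClosed k]

theorem IsAlgClosed.exists_sum_mul_pow_eq_zero {N : ℕ} (c : Fin N → k) (n : Fin N)
    (hn : (n : ℕ) ≠ 0) (hc : c n ≠ 0) : ∃ x, ∑ i, c i * x ^ (i : ℕ) = 0 := by
  set p : Polynomial k := ∑ i, Polynomial.C (c i) * Polynomial.X ^ (i : ℕ) with hp
  have hcoeff : p.coeff n = c n := by
    simp [hp, Polynomial.finsetSum_coeff, Polynomial.coeff_X_pow, Fin.val_inj]
  obtain ⟨x, hx⟩ := IsAlgClosed.exists_root p fun h => hc <| by
    rw [← hcoeff, Polynomial.eq_C_of_degree_eq_zero h, Polynomial.coeff_C_of_ne_zero hn]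
  exact ⟨x, by simpa [hp, Polynomial.IsRoot, Polynomial.eval_finsetSum] using hx⟩

theorem exists_cubic_root (b c d : k) : ∃ z, z ^ 3 + b * z ^ 2 + c * z + d = 0 := by
  obtain ⟨z, hz⟩ := IsAlgClosed.exists_sum_mul_pow_eq_zero ![d, c, b, 1] 3 (by simp) (by simp)
  exact ⟨z, by simp [Fin.sum_univ_four] at hz; linear_combination hz⟩

theorem exists_cube_root (b : k) : ∃ z, z ^ 3 = b :=
  IsAlgClosed.exists_pow_nat_eq b (by norm_num)

theorem hasSingularPoint_of_dvd_left {a : ℕ → ℕ → k} (h₁ : a 1 3 = 1)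
    (h : a 3 2 = 0 ∧ a 4 1 = 0 ∧ a 5 0 = 0) : HasSingularPoint a := by
  obtain ⟨z, hz⟩ := exists_cubic_root (a 2 2) (a 3 1) (a 4 0)
  refine ⟨0, 1, z, by simp, ?_, ?_, ?_⟩ <;> grind

theorem hasSingularPoint_of_dvd_right {a : ℕ → ℕ → k} (h₀ : a 0 3 = 0) (h₁ : a 1 3 = 1)
    (h : a 0 2 = 0 ∧ a 0 1 = 0 ∧ a 0 0 = 0) : HasSingularPoint a := by
  obtain ⟨z, hz⟩ := exists_cubic_root (a 1 2) (a 1 1) (a 1 0)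
  refine ⟨1, 0, z, by simp, ?_, ?_, ?_⟩ <;> grind

variable [CharP k 3]

theorem hasSingularPoint_of_eq_zero {a : ℕ → ℕ → k} (h₀ : a 0 3 = 0) (h₁ : a 1 3 = 1)
    (ha₂ : ∀ j, a j 2 = 0) (ha₁ : ∀ j, a j 1 = 0) : HasSingularPoint a := by
  by_cases h5 : a 5 0 = 0
  · exact hasSingularPoint_of_dvd_left h₁ ⟨ha₂ 3, ha₁ 4, h5⟩
  by_cases h0 : a 0 0 = 0
  · exact hasSingularPoint_of_dvd_right h₀ h₁ ⟨ha₂ 0, ha₁ 0, h0⟩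
  obtain ⟨y, hy⟩ := IsAlgClosed.exists_sum_mul_pow_eq_zero
    ![-a 0 0, 0, a 2 0, -a 3 0, 0, a 5 0] 5 (by simp) h5
  simp [Fin.sum_univ_six] at hy
  obtain ⟨z, hz⟩ := exists_cube_root
    (-(a 1 0 + 2 * a 2 0 * y + a 4 0 * y ^ 3 + 2 * a 5 0 * y ^ 4))
  refine ⟨1, y, z, by simp, ?_, ?_, ?_⟩ <;> simp [h₀, h₁, ha₁, ha₂, hz] <;> grind

theorem hasSingularPoint_of_node {a : ℕ → ℕ → k} (h₀ : a 0 3 = 0) (h₁ : a 1 3 = 1)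
    (h12 : a 1 2 = 0) (h22 : a 2 2 = 0) (h02 : a 0 2 ≠ 0) (h32 : a 3 2 ≠ 0) {β γ : k}
    (h01 : a 0 1 = β * a 0 2) (h11 : a 1 1 = γ * a 0 2) (h31 : a 3 1 = β * a 3 2)
    (h41 : a 4 1 = γ * a 3 2) (h00 : a 0 0 = β ^ 2 * a 0 2)
    (h20 : a 2 0 = γ ^ 2 * a 0 2 - a 2 1 * β) (h30 : a 3 0 = β ^ 2 * a 3 2 - a 2 1 * γ)
    (h50 : a 5 0 = γ ^ 2 * a 3 2) : HasSingularPoint a := by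
  obtain ⟨ε, hε⟩ : ∃ ε, a 1 0 = 2 * β * γ * a 0 2 - β ^ 3 + ε := ⟨_, (add_sub_cancel _ _).symm⟩
  obtain ⟨ζ, hζ⟩ : ∃ ζ, a 4 0 = 2 * β * γ * a 3 2 - γ ^ 3 + ζ := ⟨_, (add_sub_cancel _ _).symm⟩
  unfold HasSingularPoint
  simp only [h₀, h₁, h12, h22, h01, h11, h31, h41, h00, h20, h30, h50, hε, hζ]
  generalize a 0 2 = α at *
  generalize a 3 2 = α' at *
  generalize a 2 1 = δ at *
  by_cases hε0 : ε = 0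
  · refine ⟨1, 0, β, by simp, ?_, ?_, ?_⟩ <;> grind
  by_cases hζ0 : ζ = 0
  · refine ⟨0, 1, γ, by simp, ?_, ?_, ?_⟩ <;> grind
  obtain ⟨T, hT⟩ := IsAlgClosed.exists_sum_mul_pow_eq_zero
    ![ε * α ^ 3, ζ * α ^ 3 - δ ^ 2 * α ^ 2, δ ^ 3 - 2 * δ ^ 2 * α * α',
      ε * α' ^ 3 - δ ^ 2 * α' ^ 2, ζ * α' ^ 3] 4 (by simp) (by simp [hζ0, h32])
  simp [Fin.sum_univ_five] at hT
  have hP : δ ^ 3 * T ^ 2 + (ε + ζ * T) * (α + α' * T) ^ 3 - δ ^ 2 * T * (α + α' * T) ^ 2 = 0 := by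
    linear_combination (norm := grind) hT
  have hT0 : T ≠ 0 := by
    rintro rfl
    simp [hε0, h02] at hT
  obtain ⟨y, rfl⟩ := exists_cube_root T
  by_cases hU : α + α' * y ^ 3 = 0
  · have hδ : δ = 0 := by simpa [hU, hT0] using hP
    obtain ⟨z, hz⟩ := exists_cube_root (-(ε + ζ * y ^ 3))
    refine ⟨1, y, z + β + γ * y, by simp, ?_, ?_, ?_⟩ <;> subst hδ
    · linear_combination (norm := grind) y * hz - 2 * β * z * hU
    · linear_combination (norm := grind) hz - 2 * γ * z * hU
    · linear_combination (norm := grind) 2 * z * hU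
  · obtain ⟨z, hz⟩ : ∃ z, (α + α' * y ^ 3) * z = δ * y ^ 2 :=
      ⟨_, mul_div_cancel₀ _ hU⟩
    have hz' : z ^ 3 + 2 * δ * y * z + ε + ζ * y ^ 3 = 0 := by
      refine (mul_eq_zero.1 (?_ : (α + α' * y ^ 3) ^ 3 * _ = 0)).resolve_left (pow_ne_zero 3 hU)
      generalize α + α' * y ^ 3 = U at *
      have : U ^ 3 * z ^ 3 = δ ^ 3 * (y ^ 3) ^ 2 := by rw [← mul_pow, hz]; ring
      linear_combination (norm := grind) hP + this + 2 * δ * y * U ^ 2 * hz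
    refine ⟨1, y, z + β + γ * y, by simp, ?_, ?_, ?_⟩
    · linear_combination (norm := grind) y * hz' - 2 * β * hz
    · linear_combination (norm := grind) hz' - 2 * γ * hz
    · linear_combination (norm := grind) 2 * hz

theorem hasSingularPoint_of_cusp {a : ℕ → ℕ → k} (h₀ : a 0 3 = 1) (h₁ : a 1 3 = 0)
    (h12 : a 1 2 = 0) (h22 : a 2 2 = 0) (h32 : a 3 2 ≠ 0) {c : k} (h11 : a 1 1 = c * a 0 2)
    (h21 : a 2 1 = 0) (h41 : a 4 1 = c * a 3 2) (h10 : a 1 0 = -(c * a 0 1))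
    (h20 : a 2 0 = c ^ 2 * a 0 2) (h40 : a 4 0 = -(c * a 3 1)) (h50 : a 5 0 = c ^ 2 * a 3 2) :
    HasSingularPoint a := by
  obtain ⟨ζ, hζ⟩ : ∃ ζ, a 3 0 = -c ^ 3 + ζ := ⟨_, (add_sub_cancel _ _).symm⟩
  unfold HasSingularPoint
  simp only [h₀, h₁, h12, h22, h11, h21, h41, h10, h20, h40, h50, hζ]
  generalize a 0 2 = α at *
  generalize a 3 2 = α' at *
  generalize a 0 1 = η at *
  generalize a 3 1 = η' at *
  generalize a 0 0 = ε at *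
  obtain ⟨δ, rfl⟩ : ∃ δ, η' = δ * α' := ⟨_, (div_mul_cancel₀ _ h32).symm⟩
  obtain ⟨ζ, rfl⟩ : ∃ ζ', ζ = ζ' * α' := ⟨_, (div_mul_cancel₀ _ h32).symm⟩
  obtain ⟨γ, rfl⟩ : ∃ γ, η = γ + δ * α := ⟨_, (sub_add_cancel _ _).symm⟩
  obtain ⟨ε, rfl⟩ : ∃ ε', ε = ε' + ζ * α := ⟨_, (sub_add_cancel _ _).symm⟩
  obtain ⟨U, hU⟩ : ∃ U, (γ + δ * U) ^ 3 + 2 * U ^ 2 * (γ + δ * U) ^ 2 + U ^ 3 * (ε + ζ * U) = 0 := by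
    by_cases hγ : γ = 0
    · exact ⟨0, by simp [hγ]⟩
    have h3 : (3 : k) = 0 := CharP.cast_eq_zero k 3
    have h2 : (2 : k) ≠ 0 := by grind
    obtain ⟨U, hU⟩ := IsAlgClosed.exists_sum_mul_pow_eq_zero
      ![γ ^ 3, 0, 2 * γ ^ 2, δ ^ 3 + 4 * γ * δ + ε, 2 * δ ^ 2 + ζ] 2 (by simp) (by simp [hγ, h2])
    simp [Fin.sum_univ_five] at hU
    exact ⟨U, by linear_combination (norm := grind) hU⟩
  obtain ⟨y, hy⟩ := exists_cube_root ((U - α) / α')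
  rw [eq_div_iff h32] at hy
  have hUy : U = α + α' * y ^ 3 := by linear_combination -hy
  obtain ⟨z, hz, hz'⟩ : ∃ z, U * z = γ + δ * U ∧
      z ^ 3 + U * z ^ 2 + (γ + δ * U) * z + ε + ζ * U = 0 := by
    by_cases hU0 : U = 0
    · subst hU0
      obtain ⟨z, hz⟩ := exists_cube_root (-ε)
      have hγ : γ = 0 := by simpa using hU
      exact ⟨z, by simp [hγ], by simp [hγ, hz]⟩
    · refine ⟨(γ + δ * U) / U, by field_simp, ?_⟩
      field_simp
      linear_combination (norm := grind) hU
  refine ⟨1, y, z + c * y, by simp, ?_, ?_, ?_⟩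
  · linear_combination (norm := grind) 2 * hz'
  · linear_combination (norm := grind) c * hz
  · linear_combination (norm := grind) 2 * hz

end

section

variable {k : Type*} [Field k] [IsAlgClosed k] [CharP k 3]

theorem hasSingularPoint_of_cusp_of_rank_lt_two {F : MvPolynomial (Fin 3) k}
    (hF : F.IsHomogeneous 5) (hF₄ : ∀ j l, 4 ≤ l → quinticCoeff F j l = 0)
    (h₀ : quinticCoeff F 0 3 = 1) (h₁ : quinticCoeff F 1 3 = 0) (h₂ : quinticCoeff F 2 3 = 0)
    (h32 : quinticCoeff F 3 2 ≠ 0) (hr : (hasseWittQuintic 3 F).rank < 2) :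
    HasSingularPoint (quinticCoeff F) := by
  have M := Matrix.mul_eq_mul_of_rank_lt_two hr
  have hH := hasseWittQuintic_three_eq hF hF₄
  clear hr hF
  generalize hasseWittQuintic 3 F = H at M hH
  generalize quinticCoeff F = a at *
  dsimp only at hH
  have h3 : (3 : k) = 0 := CharP.cast_eq_zero k 3
  have h2 : (2 : k) ≠ 0 := by grind
  have e41 : H 4 1 = 2 * a 3 2 := by simp [hH, h₀, h₁, h₂]
  have e41' : H 4 1 ≠ 0 := by simp [e41, h2, h32]
  have col0 (i) : H i 0 = 0 := by
    have e40 : H 4 0 = 0 := by simp [hH, h₂]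
    simpa [e40, e41'] using M i 4 0 1
  have col2 (i) : H i 2 = 0 := by
    have e42 : H 4 2 = 0 := by simp [hH, h₁, h₂]
    simpa [e42, e41'] using M i 4 2 1
  have h22 : a 2 2 = 0 := by simpa [hH, h₀, h₁, h₂, h2] using col0 3
  have h12 : a 1 2 = 0 := by simpa [hH, h₀, h₁, h₂, h2] using col2 3
  have h21 : a 2 1 = 0 := by
    have e43 : H 4 3 = 0 := by simp [hH, h₁, h₂, h22]
    have e33 : H 3 3 = 0 := by simpa [e43, e41'] using M 3 4 3 1
    simpa [hH, h₁, h₂, h12, h22, h₀, h2] using e33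
  obtain ⟨c, h41⟩ : ∃ c, a 4 1 = c * a 3 2 := ⟨_, (div_mul_cancel₀ _ h32).symm⟩
  have h11 : a 1 1 = c * a 0 2 := by
    have := M 3 4 1 4
    simp [hH, h₀, h₁, h₂, h12, h22, h41] at this
    have : a 3 2 * (a 1 1 - c * a 0 2) = 0 := by grind
    grind
  have s7 := col2 1
  have s8 := col0 1
  have s5 := col0 2
  have s4 := col2 2
  have s2 := col0 0
  have s1 := col2 0
  simp [hH, h12, h22, h21, h41, h11] at s1 s2 s4 s5 s7 s8
  have h50 : a 5 0 = c ^ 2 * a 3 2 := by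
    have : a 3 2 * (a 5 0 - c ^ 2 * a 3 2) = 0 := by grind
    grind
  have h40 : a 4 0 = -(c * a 3 1) := by
    have : a 3 2 * (a 4 0 + c * a 3 1) = 0 := by grind
    grind
  have h10 : a 1 0 = -(c * a 0 1) := by
    have : a 3 2 * (a 1 0 + c * a 0 1) = 0 := by grind
    grind
  have h20 : a 2 0 = c ^ 2 * a 0 2 := by
    have : a 3 2 * (a 2 0 - c ^ 2 * a 0 2) = 0 := by grind
    grind
  exact hasSingularPoint_of_cusp h₀ h₁ h12 h22 h32 h11 h21 h41 h10 h20 h40 h50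

set_option maxHeartbeats 1000000 in
theorem hasSingularPoint_of_node_of_rank_lt_two {F : MvPolynomial (Fin 3) k}
    (hF : F.IsHomogeneous 5) (hF₄ : ∀ j l, 4 ≤ l → quinticCoeff F j l = 0)
    (h₀ : quinticCoeff F 0 3 = 0) (h₁ : quinticCoeff F 1 3 = 1) (h₂ : quinticCoeff F 2 3 = 0)
    (hr : (hasseWittQuintic 3 F).rank < 2) : HasSingularPoint (quinticCoeff F) := by
  have M := Matrix.mul_eq_mul_of_rank_lt_two hr
  have hout := @quinticCoeff_eq_zero k _ F
  have hH := hasseWittQuintic_three_eq hF hF₄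
  clear hr hF
  generalize hasseWittQuintic 3 F = H at M hH
  generalize quinticCoeff F = a at *
  dsimp only at hH
  have h3 : (3 : k) = 0 := CharP.cast_eq_zero k 3
  have h2 : (2 : k) ≠ 0 := by grind
  have e30 : H 3 0 = 2 * a 1 2 := by simp [hH, h₀, h₁, h₂]
  have e31 : H 3 1 = 0 := by simp [hH, h₀]
  have e32 : H 3 2 = 2 * a 0 2 := by simp [hH, h₀, h₁]
  have e40 : H 4 0 = 0 := by simp [hH, h₂]
  have e41 : H 4 1 = 2 * a 2 2 := by simp [hH, h₀, h₁, h₂]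
  have e42 : H 4 2 = 2 * a 3 2 := by simp [hH, h₁, h₂]
  by_cases h12 : a 1 2 = 0; swap
  · have e30' : H 3 0 ≠ 0 := by simp [e30, h12, h2]
    have row4 (j) : H 4 j = 0 := by simpa [e40, e30'] using M 3 4 0 j
    have e11 : H 1 1 = 0 := by simpa [e31, e30'] using M 1 3 1 0
    have h22 : a 2 2 = 0 := by simpa [e41, h2] using row4 1
    have h32 : a 3 2 = 0 := by simpa [e42, h2] using row4 2
    have h41 : a 4 1 = 0 := by simpa [hH, h₁, h₂, h22, h2] using row4 3
    have h31 : a 3 1 = 0 := by simpa [hH, h₀, h₁, h₂, h22, h32, h2] using row4 4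
    have h50 : a 5 0 = 0 := by simpa [hH, h22, h32, h31, h41, h12, h2] using e11
    exact hasSingularPoint_of_dvd_left h₁ ⟨h32, h41, h50⟩
  by_cases h22 : a 2 2 = 0; swap
  · have e41' : H 4 1 ≠ 0 := by simp [e41, h22, h2]
    have row3 (j) : H 3 j = 0 := by simpa [e31, e41'] using M 4 3 1 j
    have e00 : H 0 0 = 0 := by simpa [e40, e41'] using M 0 4 0 1
    have h02 : a 0 2 = 0 := by simpa [e32, h2] using row3 2
    have h01 : a 0 1 = 0 := by simpa [hH, h₀, h₁, h12, h2] using row3 4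
    have h11 : a 1 1 = 0 := by simpa [hH, h₀, h₁, h₂, h12, h02, h2] using row3 3
    have h00 : a 0 0 = 0 := by simpa [hH, h12, h02, h01, h11, h22, h2] using e00
    exact hasSingularPoint_of_dvd_right h₀ h₁ ⟨h02, h01, h00⟩
  have e33 : H 3 3 = 2 * a 1 1 := by simp [hH, h₀, h₁, h₂, h12, h22]
  have e34 : H 3 4 = 2 * a 0 1 := by simp [hH, h₀, h₁, h12]
  have e43 : H 4 3 = 2 * a 4 1 := by simp [hH, h₁, h₂, h22]
  have e44 : H 4 4 = 2 * a 3 1 := by simp [hH, h₀, h₁, h₂, h12, h22]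
  rw [h12, mul_zero] at e30
  rw [h22, mul_zero] at e41
  by_cases h02 : a 0 2 = 0
  · by_cases h32 : a 3 2 = 0
    · rw [h02, mul_zero] at e32
      rw [h32, mul_zero] at e42
      have key {i : Fin 5} {j : Fin 5} (hij : H i j ≠ 0) (h0 : H i 0 = 0) (h1 : H i 1 = 0)
          (h2' : H i 2 = 0) : a 0 1 = 0 ∧ a 1 1 = 0 ∧ a 3 1 = 0 ∧ a 4 1 = 0 := by
        have col0 (i') : H i' 0 = 0 := by simpa [hij, h0] using M i' i 0 j
        have col1 (i') : H i' 1 = 0 := by simpa [hij, h1] using M i' i 1 j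
        have col2 (i') : H i' 2 = 0 := by simpa [hij, h2'] using M i' i 2 j
        have s0 := col1 0
        have s2 := col0 0
        have s6 := col1 1
        have s8 := col0 1
        simp [hH, h02, h12, h22, h32] at s0 s2 s6 s8
        grind
      have hq : a 0 1 = 0 ∧ a 1 1 = 0 ∧ a 3 1 = 0 ∧ a 4 1 = 0 := by
        by_contra hne
        have f33 : H 3 3 = 0 := by by_contra h; exact hne (key h e30 e31 e32)
        have f34 : H 3 4 = 0 := by by_contra h; exact hne (key h e30 e31 e32)
        have f43 : H 4 3 = 0 := by by_contra h; exact hne (key h e40 e41 e42)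
        have f44 : H 4 4 = 0 := by by_contra h; exact hne (key h e40 e41 e42)
        rw [e33] at f33
        rw [e34] at f34
        rw [e43] at f43
        rw [e44] at f44
        simp only [mul_eq_zero, h2, false_or] at f33 f34 f43 f44
        exact hne ⟨f34, f33, f44, f43⟩
      obtain ⟨h01, h11, h31, h41⟩ := hq
      by_cases h21 : a 2 1 = 0
      · refine hasSingularPoint_of_eq_zero h₀ h₁ (fun j => ?_) fun j => ?_
        · rcases Nat.lt_or_ge j 4 with hj | hj
          · interval_cases j <;> assumption
          · exact hout (by omega)
        · rcases Nat.lt_or_ge j 5 with hj | hj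
          · interval_cases j <;> assumption
          · exact hout (by omega)
      · have h50 : a 5 0 = 0 := by
          have := M 1 2 4 2
          simpa [hH, h01, h11, h31, h41, h02, h12, h22, h32, h21, h2] using this
        exact hasSingularPoint_of_dvd_left h₁ ⟨h32, h41, h50⟩
    · have e42' : H 4 2 ≠ 0 := by simp [e42, h32, h2]
      have col1 (i) : H i 1 = 0 := by simpa [e41, e42'] using M i 4 1 2
      rw [h02, mul_zero] at e32
      have h01 : a 0 1 = 0 := by simpa [e32, e34, e42', h2] using M 3 4 4 2
      have h11 : a 1 1 = 0 := by simpa [e32, e33, e42', h2] using M 3 4 3 2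
      have h00 : a 0 0 = 0 := by
        simpa [hH, h01, h11, h02, h12, h22, h32, h2] using col1 2
      exact hasSingularPoint_of_dvd_right h₀ h₁ ⟨h02, h01, h00⟩
  · have e32' : H 3 2 ≠ 0 := by simp [e32, h02, h2]
    have col0 (i) : H i 0 = 0 := by simpa [e30, e32'] using M i 3 0 2
    have col1 (i) : H i 1 = 0 := by simpa [e31, e32'] using M i 3 1 2
    obtain ⟨γ, h11⟩ : ∃ γ, a 1 1 = γ * a 0 2 := ⟨_, (div_mul_cancel₀ _ h02).symm⟩
    obtain ⟨β, h01⟩ : ∃ β, a 0 1 = β * a 0 2 := ⟨_, (div_mul_cancel₀ _ h02).symm⟩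
    have h41 : a 4 1 = γ * a 3 2 := by
      have := M 3 4 2 3
      rw [e32, e33, e42, e43, h11] at this
      have : a 0 2 * (a 4 1 - γ * a 3 2) = 0 := by grind
      grind
    have h31 : a 3 1 = β * a 3 2 := by
      have := M 3 4 2 4
      rw [e32, e34, e42, e44, h01] at this
      have : a 0 2 * (a 3 1 - β * a 3 2) = 0 := by grind
      grind
    have s0 := col1 0
    have s2 := col0 0
    have s3 := col1 2
    have s5 := col0 2
    have s6 := col1 1
    have s8 := col0 1
    simp [hH, h12, h22, h11, h01, h41, h31] at s0 s2 s3 s5 s6 s8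
    by_cases h32 : a 3 2 = 0
    · have h50 : a 5 0 = 0 := by simpa [h32, h02, h2] using s5
      exact hasSingularPoint_of_dvd_left h₁ ⟨h32, by simp [h41, h32], h50⟩
    refine hasSingularPoint_of_node h₀ h₁ h12 h22 h02 h32 h01 h11 h31 h41 ?_ ?_ ?_ ?_
    · have : a 0 2 * (a 0 0 - β ^ 2 * a 0 2) = 0 := by grind
      grind
    · have : a 0 2 * (a 2 0 - (γ ^ 2 * a 0 2 - a 2 1 * β)) = 0 := by grind
      grind
    · have : a 3 2 * (a 3 0 - (β ^ 2 * a 3 2 - a 2 1 * γ)) = 0 := by grind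
      grind
    · have : a 3 2 * (a 5 0 - γ ^ 2 * a 3 2) = 0 := by grind
      grind

end

section

variable {k : Type*} [Field k]

theorem quinticCoeff_add (G f : MvPolynomial (Fin 3) k) (j l : ℕ) :
    quinticCoeff (G + f) j l = quinticCoeff G j l + quinticCoeff f j l := by
  unfold quinticCoeff
  split_ifs <;> simp

theorem quinticCoeff_add_of_forall_support_le {G f : MvPolynomial (Fin 3) k} {n : ℕ}
    (hf : ∀ m ∈ f.support, m 2 ≤ n) (j : ℕ) {l : ℕ} (hl : n < l) :
    quinticCoeff (G + f) j l = quinticCoeff G j l := by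
  rw [quinticCoeff_add, add_eq_left, quinticCoeff]
  split_ifs
  · by_contra h
    have := hf _ (mem_support_iff.2 h)
    simp at this
    omega
  · rfl

theorem quinticCoeff_monomial {m : Fin 3 →₀ ℕ} (hm : m 0 + m 1 + m 2 = 5) (c : k) (j l : ℕ) :
    quinticCoeff (monomial m c) j l = if m 1 = j ∧ m 2 = l then c else 0 := by
  classical
  split_ifs with h
  · obtain ⟨rfl, rfl⟩ := h
    rw [← coeff_eq_quinticCoeff hm, coeff_monomial, if_pos rfl]
  · rw [quinticCoeff, coeff_monomial]
    split_ifs with _ h'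
    · exact absurd (by simp [h']) h
    · rfl
    · rfl

end

/-- k algebraically closed of characteristic 3, X a trigonal curve of genus 5
over k. Then a(X) ≤ 3, equivalently the Hasse–Witt matrix of X has rank ≥ 2.

By Lemma 2.2.1 of the paper, X is the normalization of an irreducible plane quintic C = {F = 0}
with a unique singular point, which (after a choice of coordinates) is (0:0:1) and is either a
node (F = xyz³ + f) or a cusp (F = x²z³ + f with the coefficient of y³z² in f nonzero), where f
is a sum of monomials not divisible by z³; and by Proposition 2.3.1 the Hasse–Witt matrix of X
is `hasseWittQuintic 3 F`. Since a(X) = 5 − rank(H), the claim a(X) ≤ 3 reads rank(H) ≥ 2. -/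
theorem stmt_10 {k : Type*} [Field k] [IsAlgClosed k] [CharP k 3]
    (F f : MvPolynomial (Fin 3) k)
    (hhom : F.IsHomogeneous 5)
    (hirr : Irreducible F)
    (hf : ∀ m ∈ f.support, m 2 ≤ 2)
    (hform : F = X 0 * X 1 * X 2 ^ 3 + f ∨
      (F = X 0 ^ 2 * X 2 ^ 3 + f ∧
        MvPolynomial.coeff
          (Finsupp.single (0 : Fin 3) 0 + Finsupp.single (1 : Fin 3) 3 +
            Finsupp.single (2 : Fin 3) 2) f ≠ 0))
    (huniq : ∀ Q : Fin 3 → k, Q ≠ 0 →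
      ((∀ i, eval Q (pderiv i F) = 0) ∧ eval Q F = 0) →
      ∃ c : k, Q = c • (![0, 0, 1] : Fin 3 → k)) :
    2 ≤ (hasseWittQuintic 3 F).rank := by
  by_contra hlt
  have hr := not_le.1 hlt
  suffices h : (∀ j l, 4 ≤ l → quinticCoeff F j l = 0) ∧ quinticCoeff F 2 3 = 0 ∧
      ((∀ j l, 4 ≤ l → quinticCoeff F j l = 0) → HasSingularPoint (quinticCoeff F)) by
    obtain ⟨hF₄, h₂, hsing⟩ := h
    obtain ⟨Q, hQ, hsing⟩ := (hsing hF₄).exists_eval_pderiv_eq_zero hhom hF₄ h₂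
    obtain ⟨c, rfl⟩ := huniq Q (by rintro rfl; simp at hQ) hsing
    simp at hQ
  rcases hform with hF | ⟨hF, hcusp⟩
  · have hmon : (X 0 * X 1 * X 2 ^ 3 : MvPolynomial (Fin 3) k) =
        monomial (Finsupp.single 0 1 + Finsupp.single 1 1 + Finsupp.single 2 3) 1 := by
      simp [X, monomial_pow, monomial_mul]
    have hc (j : ℕ) {l : ℕ} (hl : 3 ≤ l) : quinticCoeff F j l = if j = 1 ∧ l = 3 then 1 else 0 := by
      rw [hF, quinticCoeff_add_of_forall_support_le hf j hl, hmon, quinticCoeff_monomial (by simp)]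
      simp [eq_comm]
    refine ⟨fun j l hl => ?_, by simp [hc], fun hF₄ => ?_⟩
    · rw [hc j (by omega), if_neg (by omega)]
    · exact hasSingularPoint_of_node_of_rank_lt_two hhom hF₄ (by simp [hc]) (by simp [hc])
        (by simp [hc]) hr
  · have hmon : (X 0 ^ 2 * X 2 ^ 3 : MvPolynomial (Fin 3) k) =
        monomial (Finsupp.single 0 2 + Finsupp.single 1 0 + Finsupp.single 2 3) 1 := by
      simp [X, monomial_pow, monomial_mul]
    have hc (j : ℕ) {l : ℕ} (hl : 3 ≤ l) : quinticCoeff F j l = if j = 0 ∧ l = 3 then 1 else 0 := by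
      rw [hF, quinticCoeff_add_of_forall_support_le hf j hl, hmon, quinticCoeff_monomial (by simp)]
      simp [eq_comm]
    have h32 : quinticCoeff F 3 2 ≠ 0 := by
      have hX : quinticCoeff (X 0 ^ 2 * X 2 ^ 3 : MvPolynomial (Fin 3) k) 3 2 = 0 := by
        rw [hmon, quinticCoeff_monomial (by simp)]
        simp
      rw [hF, quinticCoeff_add, hX, zero_add]
      simpa [quinticCoeff] using hcusp
    refine ⟨fun j l hl => ?_, by simp [hc], fun hF₄ => ?_⟩
    · rw [hc j (by omega), if_neg (by omega)]
    · exact hasSingularPoint_of_cusp_of_rank_lt_two hhom hF₄ (by simp [hc]) (by simp [hc])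
        (by simp [hc]) h32 hr
end

section
/- Let k be an algebraically closed field of characteristic p ≥ 3 and let X be a superspecial Artin–Schreier curve with equation y^p − y = f(x), where f ∈ k[x] has degree d ≥ 2 with gcd(p, d) = 1. Then X is isomorphic to the curve y^p − y = x^d and d divides p + 1. -/
open Polynomial

/-- The (modified) Cartier operator on differentials `h dx` on the x-line in characteristic p
over a perfect field: writing `h = Σ c_n x^n`, one has `C(h dx) = Σ c_{np+p−1}^{1/p} x^n dx`;
this map sends `h` to the coefficient polynomial of the resulting differential. -/
noncomputable def polyCartier (k : Type*) [Field k] (p : ℕ) [Fact p.Prime] [CharP k p]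
    [PerfectRing k p] (h : Polynomial k) : Polynomial k :=
  ∑ n ∈ Finset.range (h.natDegree + 1),
    Polynomial.C ((frobeniusEquiv k p).symm (h.coeff (n * p + (p - 1)))) * Polynomial.X ^ n

/-- If the Cartier operator kills `h dx`, the coefficients of `h` at exponents `≡ -1 mod p`
vanish. -/
theorem coeff_eq_zero_of_polyCartier_eq_zero {k : Type*} [Field k] {p : ℕ} [Fact p.Prime]
    [CharP k p] [PerfectRing k p] {h : k[X]} (hh : polyCartier k p h = 0) (n : ℕ) :
    h.coeff (n * p + (p - 1)) = 0 := by
  have hp := (Fact.out : p.Prime).pos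
  by_cases hn : n ≤ h.natDegree
  · have h1 := congrArg (fun q => q.coeff n) hh
    simp only [polyCartier, finsetSum_coeff, coeff_C_mul, coeff_X_pow, mul_ite, mul_one, mul_zero,
      Finset.sum_ite_eq, Finset.mem_range, coeff_zero] at h1
    rw [if_pos (by omega)] at h1
    simpa using h1
  · apply coeff_eq_zero_of_natDegree_lt
    have : n ≤ n * p := Nat.le_mul_of_pos_right _ hp
    omega

/-- The vanishing of the Cartier operator on `X ^ i * f ^ t`, in terms of coefficients. -/
theorem coeff_X_pow_mul_pow_eq_zero {k : Type*} [Field k] {p : ℕ} [Fact p.Prime] [CharP k p]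
    [PerfectRing k p] {f : k[X]} {d : ℕ}
    (hss : ∀ i j t : ℕ,
      ((i * p + j * d : ℕ) : ℤ) ≤ ((p : ℤ) - 1) * ((d : ℤ) - 1) - 2 → t ≤ j →
        C ((((-1) ^ t * (j.choose t : ℤ) : ℤ)) : k) * polyCartier k p (X ^ i * f ^ t) = 0)
    {i t : ℕ} (h : i * p + t * d + p + d + 1 ≤ p * d) (n : ℕ) :
    (X ^ i * f ^ t).coeff (n * p + (p - 1)) = 0 := by
  apply coeff_eq_zero_of_polyCartier_eq_zero
  have h1 := hss i t t (by zify at h ⊢; linarith) le_rfl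
  simpa using h1

/-- The degree of `f` is at most `p + 1`, because the Cartier operator sees its leading term. -/
theorem degree_le_of_superspecial {k : Type*} [Field k] {p : ℕ} [Fact p.Prime] (hp3 : 3 ≤ p)
    {f : k[X]} {d : ℕ} (hdeg : f.natDegree = d) (hd2 : 2 ≤ d) (hgcd : Nat.Coprime p d)
    (H : ∀ i t : ℕ, i * p + t * d + p + d + 1 ≤ p * d → ∀ n,
      (X ^ i * f ^ t).coeff (n * p + (p - 1)) = 0) :
    d ≤ p + 1 := by
  by_contra! hd
  have hp : p.Prime := Fact.out
  have hmod : d % p ≠ 0 := fun h =>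
    (Nat.Prime.coprime_iff_not_dvd hp).1 hgcd (Nat.dvd_of_mod_eq_zero h)
  have hlt : d % p < p := Nat.mod_lt _ hp.pos
  have hdm := Nat.div_add_mod d p
  have hw : (p - 1 - d % p) * p + 1 * d + p + d + 1 ≤ p * d := by
    have hle : p - 1 - d % p ≤ p - 2 := by omega
    by_cases h5 : 5 ≤ p
    · have := Nat.mul_le_mul_right p hle
      obtain ⟨q, rfl⟩ : ∃ q, p = q + 2 := ⟨p - 2, by omega⟩
      simp only [Nat.add_sub_cancel] at this
      nlinarith
    · have : p ≠ 4 := by rintro rfl; norm_num at hp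
      obtain rfl : p = 3 := by omega
      omega
  have h0 := H _ 1 hw (d / p)
  have he : d / p * p + (p - 1) = d + (p - 1 - d % p) := by
    have := mul_comm p (d / p)
    omega
  rw [he, pow_one, coeff_X_pow_mul, ← hdeg, coeff_natDegree, leadingCoeff_eq_zero] at h0
  simp [h0] at hdeg
  omega

/-- If `d < p`, the leading term of `f ^ ((p - 1) / d)` forces `d ∣ p + 1`. -/
theorem dvd_of_superspecial_of_lt {k : Type*} [Field k] {p : ℕ} [Fact p.Prime] (hp3 : 3 ≤ p)
    {f : k[X]} {d : ℕ} (hdeg : f.natDegree = d) (hd2 : 2 ≤ d) (hdp : d < p)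
    (H : ∀ i t : ℕ, i * p + t * d + p + d + 1 ≤ p * d → ∀ n,
      (X ^ i * f ^ t).coeff (n * p + (p - 1)) = 0) :
    d ∣ p + 1 := by
  have hp : p.Prime := Fact.out
  have hf : f ≠ 0 := by rintro rfl; simp at hdeg; omega
  obtain ⟨q, r, hqr, hrd⟩ : ∃ q r, d * q + r = p - 1 ∧ r < d :=
    ⟨(p - 1) / d, (p - 1) % d, Nat.div_add_mod _ _, Nat.mod_lt _ (by omega)⟩
  have hr1 : r ≠ d - 1 := by
    intro h
    have : d ∣ p := ⟨q + 1, by rw [mul_add]; omega⟩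
    rcases (Nat.dvd_prime hp).1 this with h | h <;> omega
  by_cases hr2 : r = d - 2
  · exact ⟨q + 1, by rw [mul_add]; omega⟩
  · exfalso
    have hw : r * p + q * d + p + d + 1 ≤ p * d := by
      obtain ⟨e, rfl⟩ : ∃ e, d = r + 3 + e := ⟨d - 3 - r, by omega⟩
      have : q * (r + 3 + e) = p - 1 - r := by rw [mul_comm]; omega
      rw [this]
      have : p * e ≥ e := Nat.le_mul_of_pos_left _ hp.pos
      have : p * (r + 3 + e) = r * p + 3 * p + p * e := by ring
      omega
    have h0 := H _ _ hw 0
    have he : 0 * p + (p - 1) = (f ^ q).natDegree + r := by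
      rw [natDegree_pow, hdeg, mul_comm q d]; omega
    rw [he, coeff_X_pow_mul, coeff_natDegree, leadingCoeff_eq_zero] at h0
    exact pow_ne_zero _ hf h0

/-- If `d < p` and `s * d = p + 1`, then `f` satisfies a first order differential equation. -/
theorem exists_differential_eq {k : Type*} [Field k] {p : ℕ} [Fact p.Prime] [CharP k p]
    {f : k[X]} {d s : ℕ} (hdeg : f.natDegree = d) (hd2 : 2 ≤ d) (hdp : d < p)
    (hs : s * d = p + 1)
    (H : ∀ i t : ℕ, i * p + t * d + p + d + 1 ≤ p * d → ∀ n,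
      (X ^ i * f ^ t).coeff (n * p + (p - 1)) = 0) :
    ∃ A B w : k, A ≠ 0 ∧ (s : k[X]) * derivative f * (C A * X + C B) - C A * f = C w := by
  have hp : p.Prime := Fact.out
  have hf : f ≠ 0 := by rintro rfl; simp at hdeg; omega
  have hs0 : s ≠ 0 := by rintro rfl; omega
  have hfs : (f ^ s).natDegree = p + 1 := by rw [natDegree_pow, hdeg, hs]
  set A := (f ^ s).coeff (p + 1) with hA
  set B := (f ^ s).coeff p with hB
  have hA0 : A ≠ 0 := by
    rw [hA, ← hfs, coeff_natDegree, Ne, leadingCoeff_eq_zero]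
    exact pow_ne_zero _ hf
  set R := f ^ s - (C A * X ^ (p + 1) + C B * X ^ p) with hR
  have hRdeg : R.natDegree ≤ p + 1 - d := by
    rw [natDegree_le_iff_coeff_eq_zero]
    intro m hm
    simp only [hR, coeff_sub, coeff_add, coeff_C_mul, coeff_X_pow]
    rcases lt_trichotomy m p with h | h | h
    · have hd : d ≤ p - 2 := by
        by_contra! h'
        obtain rfl : p = d + 1 := by omega
        have : d ∣ 2 := (Nat.dvd_add_right (dvd_refl d)).1 ⟨s, by rw [mul_comm, hs]⟩
        have := Nat.le_of_dvd (by norm_num) this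
        omega
      have hw : (p - 1 - m) * p + s * d + p + d + 1 ≤ p * d := by
        rw [hs]
        have h1 : p - 1 - m ≤ d - 3 := by omega
        have := Nat.mul_le_mul_right p h1
        obtain ⟨e, rfl⟩ : ∃ e, d = e + 3 := ⟨d - 3, by omega⟩
        simp only [Nat.add_sub_cancel] at this
        have : p * (e + 3) = e * p + 3 * p := by ring
        omega
      have h0 := H _ _ hw 0
      have he : 0 * p + (p - 1) = m + (p - 1 - m) := by omega
      rw [he, coeff_X_pow_mul] at h0
      rw [h0, if_neg (by omega), if_neg (by omega)]
      simp
    · subst h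
      simp [hB]
    · rcases (Nat.succ_le_of_lt h).eq_or_lt with h' | h'
      · subst h'
        simp [hA]
      · rw [coeff_eq_zero_of_natDegree_lt (by omega), if_neg (by omega), if_neg (by omega)]
        simp
  have hfR : f ^ s = C A * X ^ (p + 1) + C B * X ^ p + R := by rw [hR]; ring
  have hder : (s : k[X]) * f ^ (s - 1) * derivative f = C A * X ^ p + derivative R := by
    have := congrArg derivative hfR
    simpa [derivative_pow, CharP.cast_eq_zero] using this
  have hmul : ((s : k[X]) * derivative f * (C A * X + C B) - C A * f) * X ^ p
      = f * derivative R - (s : k[X]) * derivative f * R := by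
    have h1 : f * f ^ (s - 1) = f ^ s := mul_pow_sub_one hs0 f
    linear_combination f * hder - (s : k[X]) * derivative f * hfR - (s : k[X]) * derivative f * h1
  have hdf : (derivative f).natDegree ≤ d - 1 := hdeg ▸ natDegree_derivative_le f
  have hdR : (derivative R).natDegree ≤ p - d :=
    (natDegree_derivative_le R).trans (by omega)
  have hdegR : (f * derivative R - (s : k[X]) * derivative f * R).natDegree ≤ p := by
    refine (natDegree_sub_le_of_le (natDegree_mul_le_of_le hdeg.le hdR) (natDegree_mul_le_of_le
      (natDegree_mul_le_of_le (natDegree_natCast s).le hdf) hRdeg)).trans ?_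
    simp only [sup_le_iff]
    omega
  refine ⟨A, B, _, hA0, eq_C_of_natDegree_le_zero (natDegree_le_iff_coeff_eq_zero.2 ?_)⟩
  intro n hn
  rw [← coeff_mul_X_pow _ p n, hmul]
  exact coeff_eq_zero_of_natDegree_lt (by omega)

/-- If `d < p` and `s * d = p + 1`, then `f` is a translate of `a * X ^ d + b`. -/
theorem comp_eq_of_superspecial_of_lt {k : Type*} [Field k] {p : ℕ} [Fact p.Prime] [CharP k p]
    {f : k[X]} {d s : ℕ} (hdeg : f.natDegree = d) (hd2 : 2 ≤ d) (hdp : d < p)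
    (hs : s * d = p + 1)
    (H : ∀ i t : ℕ, i * p + t * d + p + d + 1 ≤ p * d → ∀ n,
      (X ^ i * f ^ t).coeff (n * p + (p - 1)) = 0) :
    ∃ a b β : k, a ≠ 0 ∧ f.comp (X + C β) = C a * X ^ d + C b := by
  obtain ⟨A, B, w, hA, hW⟩ := exists_differential_eq hdeg hd2 hdp hs H
  have hf : f ≠ 0 := by rintro rfl; simp at hdeg; omega
  set β := -(B / A) with hβ
  obtain ⟨h, hh⟩ : ∃ h, h = f.comp (X + C β) := ⟨_, rfl⟩
  have hhdeg : h.natDegree = d := by rw [hh, natDegree_comp, natDegree_X_add_C, mul_one, hdeg]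
  have hder : derivative h = (derivative f).comp (X + C β) := by
    rw [hh, derivative_comp]; simp
  have hlin : C A * (X + C β) + C B = C A * X := by
    have : A * β + B = 0 := by rw [hβ]; field_simp; ring
    rw [mul_add, add_assoc, ← C_mul, ← C_add, this, C_0, add_zero]
  have hODE : (s : k[X]) * derivative h * (C A * X) - C A * h = C w := by
    have := congrArg (fun q => q.comp (X + C β)) hW
    simpa [hlin, ← hder, ← hh] using this
  have hsd : (s : k) * d = 1 := by
    have := congrArg (Nat.cast : ℕ → k) hs
    simpa [CharP.cast_eq_zero] using this
  have hcoeff : ∀ n, n ≠ 0 → n ≠ d → h.coeff n = 0 := by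
    intro n hn hnd
    obtain ⟨m, rfl⟩ := Nat.exists_eq_succ_of_ne_zero hn
    by_contra hne
    have hle : m + 1 ≤ d := hhdeg ▸ le_natDegree_of_ne_zero hne
    have h1 := congrArg (fun q => q.coeff (m + 1)) hODE
    have h2 : (s : k[X]) * derivative h * (C A * X) = C (s * A) * (derivative h * X) := by
      rw [C_mul, C_eq_natCast]; ring
    simp only [h2, coeff_sub, coeff_C_mul, coeff_mul_X, coeff_derivative, coeff_C_succ] at h1
    have h3 : (s : k) * (m + 1) = 1 := by
      apply mul_left_cancel₀ (mul_ne_zero hA hne)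
      linear_combination h1
    have h4 : ((m + 1 : ℕ) : k) = (d : ℕ) := by
      push_cast
      linear_combination (d : k) * h3 - ((m : k) + 1) * hsd
    rw [CharP.natCast_eq_natCast k p] at h4
    have := h4.eq_of_lt_of_lt (by omega) hdp
    omega
  refine ⟨h.coeff d, h.coeff 0, β, ?_, ?_⟩
  · rw [← hhdeg, coeff_natDegree, Ne, leadingCoeff_eq_zero]
    intro h0
    rw [h0] at hhdeg
    simp at hhdeg
    omega
  · rw [← hh]
    ext n
    simp only [coeff_add, coeff_C_mul, coeff_X_pow, coeff_C]
    by_cases h0 : n = 0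
    · subst h0
      rw [if_neg (by omega)]; simp
    · by_cases hd : n = d
      · subst hd; simp [h0]
      · simp [h0, hd, hcoeff n h0 hd]

/-- The Artin–Schreier equation `v ^ p - v = c` is solvable over an algebraically closed field. -/
theorem exists_pow_sub_eq {k : Type*} [Field k] [IsAlgClosed k] {p : ℕ} (hp : 2 ≤ p) (c : k) :
    ∃ v : k, v ^ p - v = c := by
  have hdeg : (X ^ p - (X + C c) : k[X]).degree = p := by
    rw [degree_sub_eq_left_of_degree_lt] <;> rw [degree_X_pow]
    rw [degree_X_add_C]
    exact_mod_cast hp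
  obtain ⟨v, hv⟩ := IsAlgClosed.exists_root (X ^ p - (X + C c) : k[X])
    (by rw [hdeg]; exact_mod_cast (by omega : p ≠ 0))
  refine ⟨v, ?_⟩
  simp [IsRoot] at hv
  linear_combination hv

/-- In degree `p + 1`, only the exponents `p + 1`, `p`, `1` and `0` occur in `f`. -/
theorem eq_of_superspecial_of_eq {k : Type*} [Field k] {p : ℕ} [Fact p.Prime] (hp3 : 3 ≤ p)
    {f : k[X]} (hdeg : f.natDegree = p + 1)
    (H : ∀ i t : ℕ, i * p + t * (p + 1) + p + (p + 1) + 1 ≤ p * (p + 1) → ∀ n,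
      (X ^ i * f ^ t).coeff (n * p + (p - 1)) = 0) :
    f = C (f.coeff (p + 1)) * X ^ (p + 1) + C (f.coeff p) * X ^ p + C (f.coeff 1) * X
      + C (f.coeff 0) := by
  ext n
  simp only [coeff_add, coeff_C_mul, coeff_X_pow, coeff_X, coeff_C]
  by_cases h1 : n = p + 1
  · subst h1; simp [show p ≠ 0 by omega]
  by_cases h2 : n = p
  · subst h2; simp [show n ≠ 0 by omega, show 1 ≠ n by omega]
  by_cases h3 : n = 1
  · subst h3; simp [show p ≠ 0 by omega, show 1 ≠ p by omega]
  by_cases h4 : n = 0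
  · subst h4; simp [show 0 ≠ p by omega]
  simp only [h1, h2, h4, Ne.symm h3, if_false, mul_zero, add_zero]
  by_cases h5 : p + 1 < n
  · exact coeff_eq_zero_of_natDegree_lt (by omega)
  have hw : (p - 1 - n) * p + 1 * (p + 1) + p + (p + 1) + 1 ≤ p * (p + 1) := by
    have := Nat.mul_le_mul_right p (show p - 1 - n ≤ p - 3 by omega)
    obtain ⟨e, rfl⟩ : ∃ e, p = e + 3 := ⟨p - 3, by omega⟩
    simp only [Nat.add_sub_cancel] at this
    nlinarith
  have h0 := H _ _ hw 0
  rwa [show 0 * p + (p - 1) = n + (p - 1 - n) by omega, coeff_X_pow_mul, pow_one] at h0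

/-- The normal form `X ^ (p + 1)` of an additive-times-linear polynomial of degree `p + 1`. -/
theorem exists_normal_form_of_eq {k : Type*} [Field k] [IsAlgClosed k] {p : ℕ} [Fact p.Prime]
    [CharP k p] {a : k} (ha : a ≠ 0) (b c e : k) :
    ∃ (α β : k) (g : k[X]), α ≠ 0 ∧
      (C a * X ^ (p + 1) + C b * X ^ p + C c * X + C e).comp (C α * X + C β) + g ^ p - g
        = X ^ (p + 1) := by
  have hp : p.Prime := Fact.out
  obtain ⟨α, hα⟩ := IsAlgClosed.exists_pow_nat_eq (a⁻¹) (Nat.succ_pos p)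
  have hα0 : α ≠ 0 := by
    rintro rfl
    exact inv_ne_zero ha (by rw [← hα, zero_pow (by omega)])
  have hα1 : a * α ^ (p + 1) = 1 := by rw [hα, mul_inv_cancel₀ ha]
  obtain ⟨β, hβ⟩ : ∃ β : k, (a * β ^ p + c) ^ p + (a * β + b) = 0 := by
    have hdeg : ((C a * X ^ p + C c) ^ p + (C a * X + C b) : k[X]).natDegree = p * p := by
      have h1 : ((C a * X ^ p + C c) ^ p : k[X]).natDegree = p * p := by
        rw [natDegree_pow, natDegree_add_C, natDegree_C_mul_X_pow _ _ ha]
      rw [natDegree_add_eq_left_of_natDegree_lt, h1]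
      rw [h1, natDegree_linear ha]
      nlinarith [hp.two_le]
    obtain ⟨β, hβ⟩ := IsAlgClosed.exists_root
      ((C a * X ^ p + C c) ^ p + (C a * X + C b) : k[X]) (fun h => by
      have h2 := natDegree_eq_of_degree_eq_some h
      rw [hdeg] at h2
      exact (Nat.mul_pos hp.pos hp.pos).ne' h2)
    exact ⟨β, by simpa [IsRoot] using hβ⟩
  obtain ⟨v, hv⟩ := exists_pow_sub_eq hp.two_le (-(a * β ^ (p + 1) + b * β ^ p + c * β + e))
  refine ⟨α, β, C (α * (a * β ^ p + c)) * X + C v, hα0, ?_⟩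
  have h1 : (C a * C α ^ (p + 1) : k[X]) = 1 := by rw [← C_pow, ← C_mul, hα1, C_1]
  have h2 := congrArg (C : k → k[X]) hβ
  have h3 := congrArg (C : k → k[X]) hv
  simp only [map_add, map_mul, map_pow, map_sub, map_neg, map_zero] at h2 h3
  simp only [add_comp, mul_comp, pow_comp, X_comp, C_comp, pow_succ (C α * X + C β) p,
    add_pow_char, mul_pow, C_mul, C_add, C_pow] at h2 ⊢
  linear_combination X ^ (p + 1) * h1 + (C α ^ p * X ^ p) * h2 + h3

/-- Irokawa–Sasaki: k algebraically closed of characteristic p ≥ 3, X a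
superspecial Artin–Schreier curve y^p − y = f(x), f ∈ k[x] of degree d ≥ 2, gcd(p, d) = 1.
Then X is isomorphic to the curve y^p − y = x^d and d ∣ p + 1.

Formalization: a basis of H⁰(X, Ω¹_X) is given by the x^i y^j dx with
i·p + j·d ≤ (p−1)(d−1) − 2, and on these the Cartier operator is
C(x^i y^j dx) = Σ_{t ≤ j} (−1)^t binom(j,t) y^{j−t} C(x^i f^t dx), where C(h dx) is given by
`polyCartier`. Since 1, y, …, y^{p−1} are linearly independent over k(x), X being superspecial
(C ≡ 0 on H⁰(X, Ω¹_X)) is equivalent to the hypothesis `hss` below. The conclusion encodes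
the isomorphism X ≅ {y^p − y = x^d}: an affine substitution x ↦ αx + β (α ≠ 0), a scaling
y ↦ γ y with γ^(p−1) = 1, and an Artin–Schreier substitution y ↦ y + g(x) transform the
defining equation into y^p − y = x^d. -/
theorem stmt_19 (k : Type*) [Field k] [IsAlgClosed k] (p : ℕ) [Fact p.Prime] [CharP k p]
    (hp3 : 3 ≤ p) (f : Polynomial k) (d : ℕ) (hdeg : f.natDegree = d) (hd2 : 2 ≤ d)
    (hgcd : Nat.Coprime p d)
    (hss : ∀ i j t : ℕ,
      ((i * p + j * d : ℕ) : ℤ) ≤ ((p : ℤ) - 1) * ((d : ℤ) - 1) - 2 → t ≤ j →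
        Polynomial.C ((((-1) ^ t * (j.choose t : ℤ) : ℤ)) : k)
            * polyCartier k p (Polynomial.X ^ i * f ^ t) = 0) :
    d ∣ p + 1 ∧
      ∃ (α β γ : k) (g : Polynomial k), α ≠ 0 ∧ γ ≠ 0 ∧ γ ^ (p - 1) = 1 ∧
        Polynomial.C γ * f.comp (Polynomial.C α * Polynomial.X + Polynomial.C β)
            + g ^ p - g = Polynomial.X ^ d := by
  have hp : p.Prime := Fact.out
  have H : ∀ i t : ℕ, i * p + t * d + p + d + 1 ≤ p * d → ∀ n,
      (X ^ i * f ^ t).coeff (n * p + (p - 1)) = 0 :=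
    fun i t h n => coeff_X_pow_mul_pow_eq_zero hss h n
  have hle := degree_le_of_superspecial hp3 hdeg hd2 hgcd H
  have hne : d ≠ p := by
    rintro rfl
    exact hp.one_lt.ne' ((Nat.coprime_self d).1 hgcd)
  rcases hle.eq_or_lt with rfl | hlt
  · have hlead : f.coeff (p + 1) ≠ 0 := by
      rw [← hdeg, coeff_natDegree, Ne, leadingCoeff_eq_zero]
      rintro rfl
      simp at hdeg
    obtain ⟨α, β, g, hα, h⟩ :=
      exists_normal_form_of_eq (p := p) hlead (f.coeff p) (f.coeff 1) (f.coeff 0)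
    rw [← eq_of_superspecial_of_eq hp3 hdeg H] at h
    exact ⟨dvd_rfl, α, β, 1, g, hα, one_ne_zero, one_pow _, by rw [C_1, one_mul, h]⟩
  · have hdp : d < p := by omega
    have hdvd := dvd_of_superspecial_of_lt hp3 hdeg hd2 hdp H
    obtain ⟨s, hs⟩ := hdvd
    obtain ⟨a, b, β, ha, h⟩ :=
      comp_eq_of_superspecial_of_lt hdeg hd2 hdp (by rw [mul_comm, ← hs]) H
    obtain ⟨α, hα⟩ := IsAlgClosed.exists_pow_nat_eq (a⁻¹) (show 0 < d by omega)
    have hα0 : α ≠ 0 := by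
      rintro rfl
      exact inv_ne_zero ha (by rw [← hα, zero_pow (by omega)])
    obtain ⟨v, hv⟩ := exists_pow_sub_eq hp.two_le (-b)
    refine ⟨⟨s, hs⟩, α, β, 1, C v, hα0, one_ne_zero, one_pow _, ?_⟩
    have h1 : (C a * C α ^ d : k[X]) = 1 := by
      rw [← C_pow, ← C_mul, hα, mul_inv_cancel₀ ha, C_1]
    have h2 : f.comp (C α * X + C β) = C a * (C α * X) ^ d + C b := by
      have := congrArg (fun q => q.comp (C α * X)) h
      simpa [comp_assoc] using this
    have h3 := congrArg (C : k → k[X]) hv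
    simp only [map_pow, map_sub, map_neg] at h3
    rw [h2, C_1, one_mul, mul_pow]
    linear_combination X ^ d * h1 + h3
end
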